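/- arXiv:1601.00943 — 2 statements merged into one kernel-verified Lean document; each statement's English description precedes it below -/
import Mathlib

section
/- If F₁,…,Fₙ (n > 1) are matchings in a bipartite graph, each of size at least ⌈3n/2⌉ + 1, then there exists a full rainbow matching. -/
/-- Two edges of a bipartite graph (encoded as pairs side-U × side-W) are vertex-disjoint. -/
def EdgeDisj {α β : Type*} (e f : α × β) : Prop := e.1 ≠ f.1 ∧ e.2 ≠ f.2

/-- A finite set of bipartite edges is a matching: distinct edges are vertex-disjoint. -/
def IsMatching {α β : Type*} (M : Finset (α × β)) : Prop :=
  ∀ e ∈ M, ∀ f ∈ M, e ≠ f → EdgeDisj e f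

/-- A full rainbow matching: one edge from each `F i`, pairwise vertex-disjoint. -/
def HasFullRainbow {α β : Type*} {n : ℕ} (F : Fin n → Finset (α × β)) : Prop :=
  ∃ g : Fin n → α × β, (∀ i, g i ∈ F i) ∧ ∀ i j, i ≠ j → EdgeDisj (g i) (g j)

/-- `g` picks disjoint edges from all the matchings `F i` except `F c`. -/
def IsNearRainbow {α β ι : Type*} (F : ι → Finset (α × β)) (c : ι) (g : ι → α × β) : Prop :=
  (∀ i, i ≠ c → g i ∈ F i) ∧ ∀ i j, i ≠ c → j ≠ c → i ≠ j → EdgeDisj (g i) (g j)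

open Classical in
/-- The edges of `F l` that avoid all the edges `g i` with `i ≠ c`. -/
noncomputable def freeEdges {α β ι : Type*} (F : ι → Finset (α × β)) (c : ι) (g : ι → α × β)
    (l : ι) : Finset (α × β) :=
  (F l).filter fun e => (∀ i, i ≠ c → (g i).1 ≠ e.1) ∧ ∀ i, i ≠ c → (g i).2 ≠ e.2

/-- Some edge of `M` joins `b` to a left vertex avoided by all the edges `g i` with `i ≠ c`. -/
def HitFromFree {α β ι : Type*} (M : Finset (α × β)) (c : ι) (g : ι → α × β) (b : β) : Prop :=
  ∃ u, (u, b) ∈ M ∧ ∀ i, i ≠ c → (g i).1 ≠ u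

theorem IsMatching.injOn_fst {α β : Type*} {M : Finset (α × β)} (h : IsMatching M) :
    Set.InjOn Prod.fst (M : Set (α × β)) := by
  intro e he f hf hef
  by_contra hne
  exact (h e he f hf hne).1 hef

theorem IsMatching.injOn_snd {α β : Type*} {M : Finset (α × β)} (h : IsMatching M) :
    Set.InjOn Prod.snd (M : Set (α × β)) := by
  intro e he f hf hef
  by_contra hne
  exact (h e he f hf hne).2 hef

section

variable {α β ι : Type*} [DecidableEq ι]

open Classical in
theorem card_le_add_hitFromFree [Fintype ι] {F : ι → Finset (α × β)} {c : ι} {g : ι → α × β}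
    {l : ι} (hM : IsMatching (F l)) :
    (F l).card ≤ (Finset.univ.erase c).card
      + ((Finset.univ.erase c).filter fun k => HitFromFree (F l) c g (g k).2).card
      + (freeEdges F c g l).card := by
  set K := Finset.univ.erase c with hK
  set A := (F l).filter fun e => ∃ i, i ≠ c ∧ (g i).1 = e.1
  set B := (F l).filter fun e => (∀ i, i ≠ c → (g i).1 ≠ e.1) ∧ ∃ i, i ≠ c ∧ (g i).2 = e.2
  have hsub : F l ⊆ A ∪ B ∪ freeEdges F c g l := by
    intro e he
    simp only [Finset.mem_union, A, B, freeEdges, Finset.mem_filter]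
    grind
  have hA : A.card ≤ K.card := by
    have h1 : A.card = (A.image Prod.fst).card := by
      rw [Finset.card_image_of_injOn]
      exact hM.injOn_fst.mono (Finset.coe_subset.2 (Finset.filter_subset _ _))
    rw [h1]
    refine (Finset.card_le_card (t := K.image fun i => (g i).1) ?_).trans Finset.card_image_le
    intro a ha
    simp only [Finset.mem_image, A, hK, Finset.mem_filter, Finset.mem_erase] at ha ⊢
    grind
  have hB : B.card ≤ (K.filter fun k => HitFromFree (F l) c g (g k).2).card := by
    have h1 : B.card = (B.image Prod.snd).card := by
      rw [Finset.card_image_of_injOn]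
      exact hM.injOn_snd.mono (Finset.coe_subset.2 (Finset.filter_subset _ _))
    rw [h1]
    refine (Finset.card_le_card
      (t := (K.filter fun k => HitFromFree (F l) c g (g k).2).image fun i => (g i).2) ?_).trans
      Finset.card_image_le
    intro b hb
    simp only [Finset.mem_image, B, hK, Finset.mem_filter, Finset.mem_erase] at hb ⊢
    obtain ⟨⟨u, b'⟩, ⟨he, h2, i, hi, hib⟩, rfl⟩ := hb
    exact ⟨i, ⟨⟨hi, Finset.mem_univ _⟩, u, by simpa [hib] using he, h2⟩, hib⟩
  have h2 := Finset.card_le_card hsub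
  have h3 := Finset.card_union_le (A ∪ B) (freeEdges F c g l)
  have h4 := Finset.card_union_le A B
  omega

open Classical in
theorem card_le_add_missing [Fintype ι] {F : ι → Finset (α × β)} {c : ι} {g : ι → α × β}
    (hM : IsMatching (F c)) (hfree : freeEdges F c g c = ∅) :
    (F c).card ≤ (Finset.univ.erase c).card
      + ((Finset.univ.erase c).filter fun k =>
          ∃ w, ((g k).1, w) ∈ F c ∧ ∀ i, i ≠ c → (g i).2 ≠ w).card := by
  set K := Finset.univ.erase c with hK
  set Y := K.filter fun k => ∃ w, ((g k).1, w) ∈ F c ∧ ∀ i, i ≠ c → (g i).2 ≠ w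
  set A := (F c).filter fun e => ∃ i, i ≠ c ∧ (g i).2 = e.2
  set B := (F c).filter fun e => ∀ i, i ≠ c → (g i).2 ≠ e.2
  have hsub : F c ⊆ A ∪ B := by
    intro e he
    simp only [Finset.mem_union, A, B, Finset.mem_filter]
    grind
  have hA : A.card ≤ K.card := by
    have h1 : A.card = (A.image Prod.snd).card := by
      rw [Finset.card_image_of_injOn]
      exact hM.injOn_snd.mono (Finset.coe_subset.2 (Finset.filter_subset _ _))
    rw [h1]
    refine (Finset.card_le_card (t := K.image fun i => (g i).2) ?_).trans Finset.card_image_le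
    intro a ha
    simp only [Finset.mem_image, A, hK, Finset.mem_filter, Finset.mem_erase] at ha ⊢
    grind
  have hB : B.card ≤ Y.card := by
    have h1 : B.card = (B.image Prod.fst).card := by
      rw [Finset.card_image_of_injOn]
      exact hM.injOn_fst.mono (Finset.coe_subset.2 (Finset.filter_subset _ _))
    rw [h1]
    refine (Finset.card_le_card (t := Y.image fun i => (g i).1) ?_).trans Finset.card_image_le
    intro b hb
    simp only [Finset.mem_image, B, Y, hK, Finset.mem_filter, Finset.mem_erase] at hb ⊢
    obtain ⟨⟨u, w⟩, ⟨he, h2⟩, rfl⟩ := hb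
    have : ∃ i, i ≠ c ∧ (g i).1 = u := by
      by_contra! hcon
      have : (u, w) ∈ freeEdges F c g c := by
        simp only [freeEdges, Finset.mem_filter]
        exact ⟨he, hcon, h2⟩
      simp [hfree] at this
    obtain ⟨i, hi, hiu⟩ := this
    exact ⟨i, ⟨⟨hi, Finset.mem_univ _⟩, w, by simpa [hiu] using he, h2⟩, hiu⟩
  have h2 := Finset.card_le_card hsub
  have h4 := Finset.card_union_le A B
  omega

/-- Give color `c` the edge from the left end of `g k` to a free vertex `w`, releasing color `k`. -/
theorem IsNearRainbow.switch {F : ι → Finset (α × β)} {c k : ι} {g : ι → α × β}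
    (hg : IsNearRainbow F c g) (hk : k ≠ c) {w : β} (hw : ((g k).1, w) ∈ F c)
    (hfree : ∀ i, i ≠ c → (g i).2 ≠ w) :
    IsNearRainbow F k (Function.update g c ((g k).1, w)) := by
  obtain ⟨h1, h2⟩ := hg
  unfold EdgeDisj at h2
  constructor
  · intro i hi
    by_cases hic : i = c
    · subst hic; simpa using hw
    · simpa [hic] using h1 i hic
  · intro i j hi hj hij
    unfold EdgeDisj
    by_cases hic : i = c <;> by_cases hjc : j = c
    · exact absurd (hic.trans hjc.symm) hij
    · subst hic
      simp only [Function.update_self, Function.update_of_ne hjc]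
      exact ⟨(h2 k j hk hjc (Ne.symm hj)).1, (hfree j hjc).symm⟩
    · subst hjc
      simp only [Function.update_self, Function.update_of_ne hic]
      exact ⟨(h2 i k hic hk hi).1, hfree i hic⟩
    · simp only [Function.update_of_ne hic, Function.update_of_ne hjc]
      exact h2 i j hic hjc hij

/-- A free edge of the missing color completes a near-rainbow matching. -/
theorem IsNearRainbow.freeEdges_eq_empty {F : ι → Finset (α × β)} {c : ι} {g : ι → α × β}
    (hg : IsNearRainbow F c g)
    (hno : ¬ ∃ g : ι → α × β, (∀ i, g i ∈ F i) ∧ ∀ i j, i ≠ j → EdgeDisj (g i) (g j)) :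
    freeEdges F c g c = ∅ := by
  obtain ⟨h1, h2⟩ := hg
  rw [Finset.eq_empty_iff_forall_notMem]
  intro e he
  simp only [freeEdges, Finset.mem_filter] at he
  obtain ⟨he, hf1, hf2⟩ := he
  refine hno ⟨Function.update g c e, ?_, ?_⟩
  · intro i
    by_cases hic : i = c
    · subst hic; simpa using he
    · simpa [hic] using h1 i hic
  · intro i j hij
    by_cases hic : i = c <;> by_cases hjc : j = c
    · exact absurd (hic.trans hjc.symm) hij
    · subst hic
      simp only [Function.update_self, Function.update_of_ne hjc]
      exact ⟨(hf1 j hjc).symm, (hf2 j hjc).symm⟩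
    · subst hjc
      simp only [Function.update_self, Function.update_of_ne hic]
      exact ⟨hf1 i hic, hf2 i hic⟩
    · simp only [Function.update_of_ne hic, Function.update_of_ne hjc]
      exact h2 i j hic hjc hij

open Classical in
theorem IsNearRainbow.card_freeEdges_switch {F : ι → Finset (α × β)} {c k l : ι} {g : ι → α × β}
    (hg : IsNearRainbow F c g) (hM : IsMatching (F l)) (hk : k ≠ c) {w : β}
    (hfree : ∀ i, i ≠ c → (g i).2 ≠ w) :
    (freeEdges F c g l).card + (if HitFromFree (F l) c g (g k).2 then 1 else 0) ≤
      (freeEdges F k (Function.update g c ((g k).1, w)) l).card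
        + (if HitFromFree (F l) c g w then 1 else 0) := by
  obtain ⟨h1, h2⟩ := hg
  unfold EdgeDisj at h2
  set g' := Function.update g c ((g k).1, w) with hg'
  have hc' : g' c = ((g k).1, w) := by simp [hg']
  have hi' : ∀ i, i ≠ c → g' i = g i := fun i hi => by simp [hg', hi]
  have hmem : ∀ e ∈ F l, (∀ i, i ≠ c → (g i).1 ≠ e.1) → e.2 ≠ w →
      (∀ i, i ≠ c → i ≠ k → (g i).2 ≠ e.2) → e ∈ freeEdges F k g' l := by
    intro e he ha hew hb
    simp only [freeEdges, Finset.mem_filter]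
    refine ⟨he, fun i hi => ?_, fun i hi => ?_⟩
    · by_cases hic : i = c
      · rw [hic, hc']; exact ha k hk
      · rw [hi' i hic]; exact ha i hic
    · by_cases hic : i = c
      · rw [hic, hc']; exact hew.symm
      · rw [hi' i hic]; exact hb i hic hi
  set O := (freeEdges F c g l).filter fun e => e.2 ≠ w with hO
  have hOsub : O ⊆ freeEdges F k g' l := by
    intro e he
    simp only [hO, freeEdges, Finset.mem_filter] at he
    exact hmem e he.1.1 he.1.2.1 he.2 fun i hi _ => he.1.2.2 i hi
  have hOcard : (freeEdges F c g l).card ≤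
      O.card + (if HitFromFree (F l) c g w then 1 else 0) := by
    rw [← Finset.card_filter_add_card_filter_not (s := freeEdges F c g l) (fun e => e.2 ≠ w)]
    gcongr
    split_ifs with h
    · rw [Finset.card_le_one]
      intro e he f hf
      simp only [freeEdges, Finset.mem_filter, not_not] at he hf
      exact hM.injOn_snd he.1.1 hf.1.1 (he.2.trans hf.2.symm)
    · rw [Nat.le_zero, Finset.card_eq_zero, Finset.eq_empty_iff_forall_notMem]
      rintro ⟨u, b⟩ he
      simp only [freeEdges, Finset.mem_filter, not_not] at he
      obtain ⟨⟨he, h3, -⟩, rfl⟩ := he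
      exact h ⟨u, he, h3⟩
  have hOb : O.card + (if HitFromFree (F l) c g (g k).2 then 1 else 0) ≤
      (freeEdges F k g' l).card := by
    split_ifs with h
    · obtain ⟨u, hu, hfu⟩ := h
      have hnot : (u, (g k).2) ∉ O := by
        intro hmO
        simp only [hO, freeEdges, Finset.mem_filter] at hmO
        exact hmO.1.2.2 k hk rfl
      rw [← Finset.card_insert_of_notMem hnot]
      refine Finset.card_le_card (Finset.insert_subset ?_ hOsub)
      exact hmem _ hu hfu (hfree k hk) fun i hi hik => (h2 i k hi hk hik).2
    · simpa using Finset.card_le_card hOsub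
  omega

open Classical in
theorem exists_rainbow_of_isNearRainbow [Fintype ι] {F : ι → Finset (α × β)}
    (hM : ∀ i, IsMatching (F i)) (hcard : ∀ i, 3 * Fintype.card ι + 2 ≤ 2 * (F i).card) {c₀ : ι} {g₀ : ι → α × β}
    (hg₀ : IsNearRainbow F c₀ g₀) :
    ∃ g : ι → α × β, (∀ i, g i ∈ F i) ∧ ∀ i j, i ≠ j → EdgeDisj (g i) (g j) := by
  by_contra hno
  let Φ : ι × (ι → α × β) → ℕ := fun p => ∑ l, min (freeEdges F p.1 p.2 l).card 2
  have hΦ : ∀ p, Φ p ≤ 2 * Fintype.card ι := by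
    intro p
    calc Φ p ≤ ∑ _l : ι, 2 := Finset.sum_le_sum fun l _ => min_le_right _ _
      _ = 2 * Fintype.card ι := by simp [mul_comm]
  obtain ⟨⟨c, g⟩, hg, hmin⟩ := (measure fun p => 2 * Fintype.card ι - Φ p).wf.has_min
    {p | IsNearRainbow F p.1 p.2} ⟨(c₀, g₀), hg₀⟩
  have hmax : ∀ c' g', IsNearRainbow F c' g' → Φ (c', g') ≤ Φ (c, g) := by
    intro c' g' h'
    have h3 : ¬ (2 * Fintype.card ι - Φ (c', g') < 2 * Fintype.card ι - Φ (c, g)) :=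
      hmin (c', g') h'
    have := hΦ (c', g')
    have := hΦ (c, g)
    omega
  simp only [Set.mem_ofPred_eq] at hg
  have hK : (Finset.univ.erase c).card + 1 = Fintype.card ι := by
    rw [Finset.card_erase_add_one (Finset.mem_univ c), Finset.card_univ]
  set o : ι → ℕ := fun l => (freeEdges F c g l).card with ho
  set Y := (Finset.univ.erase c).filter fun k =>
    ∃ w, ((g k).1, w) ∈ F c ∧ ∀ i, i ≠ c → (g i).2 ≠ w with hY
  have hYcard : (F c).card ≤ (Finset.univ.erase c).card + Y.card :=
    card_le_add_missing (hM c) (hg.freeEdges_eq_empty hno)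
  have hYmem : ∀ k ∈ Y, k ≠ c ∧ ∃ w, ((g k).1, w) ∈ F c ∧ ∀ i, i ≠ c → (g i).2 ≠ w := by
    intro k hk
    simpa [hY] using hk
  have : Nonempty β := ⟨(g c).2⟩
  choose! hYc w hw hwfree using hYmem
  have hYo : ∀ k ∈ Y, o k ≤ 1 := by
    intro k hk
    have h3 := hg.card_freeEdges_switch (hM k) (hYc k hk) (hwfree k hk)
    rw [(hg.switch (hYc k hk) (hw k hk) (hwfree k hk)).freeEdges_eq_empty hno] at h3
    change o k + _ ≤ _ at h3
    rw [Finset.card_empty] at h3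
    split_ifs at h3 <;> omega
  have hstep : ∀ k ∈ Y,
      ∑ l, (if o l < 2 ∧ HitFromFree (F l) c g (g k).2 then 1 else 0) ≤
        ∑ l, (if o l ≤ 2 ∧ HitFromFree (F l) c g (w k) then 1 else 0) := by
    intro k hk
    have h3 := hmax _ _ (hg.switch (hYc k hk) (hw k hk) (hwfree k hk))
    have h4 : ∑ l, (min (o l) 2 + (if o l < 2 ∧ HitFromFree (F l) c g (g k).2 then 1 else 0)) ≤
        ∑ l, (min (freeEdges F k (Function.update g c ((g k).1, w k)) l).card 2
          + (if o l ≤ 2 ∧ HitFromFree (F l) c g (w k) then 1 else 0)) := by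
      refine Finset.sum_le_sum fun l _ => ?_
      have h5 := hg.card_freeEdges_switch (hM l) (hYc k hk) (hwfree k hk)
      change o l + _ ≤ _ at h5
      grind
    rw [Finset.sum_add_distrib, Finset.sum_add_distrib] at h4
    simp only [Φ] at h3
    change _ ≤ ∑ l, min (o l) 2 at h3
    omega
  have hsum := Finset.sum_le_sum hstep
  rw [Finset.sum_comm, Finset.sum_comm (s := Y)] at hsum
  have hleft : ∀ l, (if o l < 2 then 5 - o l else 0) ≤
      ∑ k ∈ Y, (if o l < 2 ∧ HitFromFree (F l) c g (g k).2 then 1 else 0) := by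
    intro l
    split_ifs with hl
    · simp only [hl, true_and, Finset.sum_boole, Nat.cast_id]
      have h3 := card_le_add_hitFromFree (c := c) (g := g) (hM l)
      change _ ≤ _ + o l at h3
      set X := (Finset.univ.erase c).filter fun k => HitFromFree (F l) c g (g k).2 with hX
      have h4 : X ∩ Y ⊆ Y.filter fun k => HitFromFree (F l) c g (g k).2 := by
        intro k hk
        simp only [hX, Finset.mem_inter, Finset.mem_filter] at hk ⊢
        exact ⟨hk.2, hk.1.2⟩
      have h5 := Finset.card_le_card h4
      have h6 := Finset.card_union_add_card_inter X Y
      have h7 : (X ∪ Y).card ≤ (Finset.univ.erase c).card :=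
        Finset.card_le_card
          (Finset.union_subset (Finset.filter_subset _ _) (Finset.filter_subset _ _))
      have h8 := hcard l
      have h9 := hcard c
      omega
    · exact Nat.zero_le _
  have hright : ∀ l, ∑ k ∈ Y, (if o l ≤ 2 ∧ HitFromFree (F l) c g (w k) then 1 else 0) ≤
      (if o l ≤ 2 then o l else 0) := by
    intro l
    by_cases hl : o l ≤ 2
    · simp only [hl, true_and, if_true, Finset.sum_boole, Nat.cast_id]
      have h3 : Set.InjOn w (Y : Set ι) := by
        intro i hi j hj hij
        by_contra hne
        have h4 := (hM c).injOn_snd (hw i hi) (hw j hj) hij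
        exact (hg.2 i j (hYc i hi) (hYc j hj) hne).1 (Prod.ext_iff.1 h4).1
      rw [← Finset.card_image_of_injOn (f := w) (h3.mono (Finset.coe_subset.2 (Finset.filter_subset _ _)))]
      refine (Finset.card_le_card (t := (freeEdges F c g l).image Prod.snd) ?_).trans
        Finset.card_image_le
      intro b hb
      simp only [Finset.mem_image, Finset.mem_filter] at hb
      obtain ⟨k, ⟨hk, u, hu, hfu⟩, rfl⟩ := hb
      refine Finset.mem_image.2 ⟨(u, w k), ?_, rfl⟩
      simp only [freeEdges, Finset.mem_filter]
      exact ⟨hu, hfu, hwfree k hk⟩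
    · simp [hl]
  have htot := ((Finset.sum_le_sum fun l (_ : l ∈ Finset.univ) => hleft l).trans hsum).trans
    (Finset.sum_le_sum fun l _ => hright l)
  have hfinal : ∑ l, ((if o l ≤ 2 then o l else 0) + (if l ∈ Y then 5 else 0)) ≤
      ∑ l, ((if o l < 2 then 5 - o l else 0) + 2) := by
    refine Finset.sum_le_sum fun l _ => ?_
    have := hYo l
    grind
  rw [Finset.sum_add_distrib, Finset.sum_add_distrib] at hfinal
  have h3 : ∑ l, (if l ∈ Y then 5 else 0) = 5 * Y.card := by
    simp [mul_comm]
  have h4 : ∑ _l : ι, 2 = 2 * Fintype.card ι := by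
    simp [mul_comm]
  have h5 := hcard c
  omega

end

theorem hasFullRainbow_of_card {α β : Type*} (n : ℕ) (F : Fin n → Finset (α × β))
    (hmatch : ∀ i, IsMatching (F i)) (hcard : ∀ i, 3 * n + 2 ≤ 2 * (F i).card) :
    HasFullRainbow F := by
  induction n with
  | zero => exact ⟨fun i => i.elim0, fun i => i.elim0, fun i => i.elim0⟩
  | succ n ih =>
    obtain ⟨g, hg1, hg2⟩ := ih (fun i => F i.castSucc) (fun i => hmatch _)
      (fun i => le_trans (by omega) (hcard i.castSucc))
    obtain ⟨e, he⟩ : (F (Fin.last n)).Nonempty := by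
      rw [← Finset.card_pos]
      have := hcard (Fin.last n)
      omega
    refine exists_rainbow_of_isNearRainbow (c₀ := Fin.last n)
      (g₀ := Fin.snoc (α := fun _ => α × β) g e) hmatch (by simpa using hcard) ⟨?_, ?_⟩
    · intro i
      refine Fin.lastCases (fun h => absurd rfl h) (fun i _ => ?_) i
      simpa using hg1 i
    · intro i j
      refine Fin.lastCases (fun h => absurd rfl h) (fun i _ => ?_) i
      refine Fin.lastCases (fun h => absurd rfl h) (fun j _ hij => ?_) j
      simpa using hg2 i j fun h => hij (congrArg _ h)

theorem stmt4 {α β : Type*} (n : ℕ) (hn : 1 < n) (F : Fin n → Finset (α × β))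
    (hmatch : ∀ i, IsMatching (F i)) (hcard : ∀ i, (3 * n + 1) / 2 + 1 ≤ (F i).card) :
    HasFullRainbow F := by
  refine hasFullRainbow_of_card n F hmatch fun i => ?_
  have := hcard i
  omega
end

section
/- Let R be a maximum-size rainbow matching for matchings F₁,…,Fₙ in a bipartite graph with sides U, W, with |R| = n−1, Fₙ ∩ R = ∅, and X ⊆ U, Y ⊆ W the vertices uncovered by R. Suppose Fᵢ (i < n) contains an edge rᵢ ∈ R such that some edge eᵢ of Fₙ joins a vertex of Y to the U-endpoint of rᵢ. Then Fᵢ contains at most one edge with one endpoint in X and the other in Y. -/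
/-- `S, g` is a (partial) rainbow matching for the family `F`:
for each index `i ∈ S` an edge `g i ∈ F i`, pairwise vertex-disjoint. -/
def IsRainbow {α β : Type*} {n : ℕ} (F : Fin n → Finset (α × β))
    (S : Finset (Fin n)) (g : Fin n → α × β) : Prop :=
  (∀ i ∈ S, g i ∈ F i) ∧ ∀ i ∈ S, ∀ j ∈ S, i ≠ j → EdgeDisj (g i) (g j)

/-- Reassigning the index `i` of a rainbow matching to an edge `e` of `F i` avoiding the matching,
and an index `k` to an edge `d` that meets the matching at most in the first vertex of `g i`,
gives a rainbow matching for `insert k S`. -/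
theorem IsRainbow.insert_update {α β : Type*} {n : ℕ} {F : Fin n → Finset (α × β)}
    {S : Finset (Fin n)} {g : Fin n → α × β} (hR : IsRainbow F S g) {i k : Fin n}
    (hi : i ∈ S) {d e : α × β} (hd : d ∈ F k) (he : e ∈ F i)
    (hd1 : d.1 = (g i).1) (hd2 : ∀ j ∈ S, (g j).2 ≠ d.2)
    (he1 : ∀ j ∈ S, (g j).1 ≠ e.1) (he2 : ∀ j ∈ S, (g j).2 ≠ e.2) (hed : e.2 ≠ d.2) :
    IsRainbow F (insert k S) (Function.update (Function.update g i e) k d) := by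
  obtain ⟨hmem, hdisj⟩ := hR
  have hd1' : ∀ j ∈ S, j ≠ i → (g j).1 ≠ d.1 := fun j hj hji =>
    hd1 ▸ (hdisj j hj i hi hji).1
  have he1' : e.1 ≠ d.1 := fun h => he1 i hi (hd1.symm.trans h.symm)
  refine ⟨?_, ?_⟩
  · intro a ha
    grind [Function.update_apply]
  · intro a ha b hb hab
    grind [Function.update_apply, EdgeDisj]

theorem stmt6 {α β : Type*} (n : ℕ) (hn : 1 < n) (F : Fin n → Finset (α × β))
    (hmatch : ∀ i, IsMatching (F i))
    (S : Finset (Fin n)) (g : Fin n → α × β)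
    (hR : IsRainbow F S g) (hcard : S.card = n - 1)
    (hlast : (⟨n - 1, by omega⟩ : Fin n) ∉ S)
    (hmax : ∀ (S' : Finset (Fin n)) (g' : Fin n → α × β),
      IsRainbow F S' g' → S'.card ≤ S.card)
    (i : Fin n) (hi : i ∈ S)
    (ei : α × β) (hei : ei ∈ F ⟨n - 1, by omega⟩)
    -- ei joins the U-endpoint of g i to a vertex of Y (not covered by R)
    (hei1 : ei.1 = (g i).1) (hei2 : ∀ j ∈ S, (g j).2 ≠ ei.2) :
    -- F i has at most one edge with U-endpoint in X and W-endpoint in Y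
    ∀ e ∈ F i, ∀ f ∈ F i,
      ((∀ j ∈ S, (g j).1 ≠ e.1) ∧ (∀ j ∈ S, (g j).2 ≠ e.2)) →
      ((∀ j ∈ S, (g j).1 ≠ f.1) ∧ (∀ j ∈ S, (g j).2 ≠ f.2)) →
      e = f := by
  have key : ∀ e ∈ F i,
      ((∀ j ∈ S, (g j).1 ≠ e.1) ∧ (∀ j ∈ S, (g j).2 ≠ e.2)) → e.2 = ei.2 := by
    intro e he hfree
    by_contra hne
    have h := hmax _ _ (hR.insert_update hi hei he hei1 hei2 hfree.1 hfree.2 hne)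
    rw [Finset.card_insert_of_notMem hlast] at h
    omega
  intro e he f hf hfe hff
  by_contra hne
  exact (hmatch i e he f hf hne).2 ((key e he hfe).trans (key f hf hff).symm)
end
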